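/- arXiv:2508.18494 — 6 statements merged into one kernel-verified Lean document; each statement's English description precedes it below -/
import Mathlib

section
/- Let C ≥ 1 and let v_1, …, v_n be an enumeration of a finite vertex set V (each vertex loaded exactly once) processed by an initially empty cache of capacity C under the LIFO eviction policy. Then for distinct vertices u, w ∈ V, the pair {u, w} is covered by this schedule if and only if at least one of u, w occurs among the first C − 1 loaded vertices v_1, …, v_{C−1}, or both u and w occur among v_1, …, v_{min(C,n)}. -/
/-- The cache state (as a stack, most recently loaded first) after loading the
vertices of `l` in order into an initially empty cache of capacity `C` under
the LIFO eviction policy: if the cache is full, the most recently loaded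
cached vertex (the head of the stack) is evicted. -/
def lifoRun {V : Type*} (C : ℕ) (l : List V) : List V :=
  l.foldl (fun s x => if s.length < C then x :: s else x :: s.tail) []

/-- A pair of vertices `u, w` is covered by the LIFO schedule of load sequence `l`
with capacity `C` if at some moment both are in the cache simultaneously. -/
def coveredLIFO {V : Type*} (C : ℕ) (l : List V) (u w : V) : Prop :=
  ∃ i ≤ l.length, u ∈ lifoRun C (l.take i) ∧ w ∈ lifoRun C (l.take i)

theorem lifoRun_append_singleton {V : Type*} {C : ℕ} (hC : 1 ≤ C) (l : List V) (x : V) :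
    lifoRun C (l ++ [x]) = x :: (l.take (C - 1)).reverse := by
  induction l using List.reverseRecOn generalizing x with
  | nil => simp [lifoRun]
  | append_singleton l y ih =>
    have step : lifoRun C (l ++ [y] ++ [x]) =
        if (lifoRun C (l ++ [y])).length < C then x :: lifoRun C (l ++ [y])
        else x :: (lifoRun C (l ++ [y])).tail := by
      simp [lifoRun]
    rw [step, ih y]
    split_ifs with h
    · have hl : l.length + 1 ≤ C - 1 := by
        simp only [List.length_cons, List.length_reverse, List.length_take] at h
        omega
      rw [List.take_of_length_le (by omega), List.take_of_length_le (by simpa using hl)]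
      simp
    · have hl : C - 1 ≤ l.length := by
        simp only [List.length_cons, List.length_reverse, List.length_take] at h
        omega
      rw [List.take_append_of_le_length hl, List.tail_cons]

theorem mem_take_ofFn_iff {V : Type*} {n : ℕ} (e : Fin n ≃ V) (v : V) (m : ℕ) :
    v ∈ (List.ofFn fun j => e j).take m ↔ (e.symm v : ℕ) < m := by
  rw [List.mem_take_iff_getElem]
  constructor
  · rintro ⟨k, hk, rfl⟩
    simp only [List.getElem_ofFn, Equiv.symm_apply_apply]
    omega
  · intro h
    exact ⟨e.symm v, by simpa using h, by simp⟩

theorem mem_lifoRun_take_succ_iff {V : Type*} {n C : ℕ} (hC : 1 ≤ C) (e : Fin n ≃ V) (v : V)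
    {k : ℕ} (hk : k < n) :
    v ∈ lifoRun C ((List.ofFn fun j => e j).take (k + 1)) ↔
      (e.symm v : ℕ) = k ∨ (e.symm v : ℕ) < min (C - 1) k := by
  rw [← List.take_concat_get' _ _ (by simpa using hk), lifoRun_append_singleton hC,
    List.mem_cons, List.mem_reverse, List.take_take, mem_take_ofFn_iff, List.getElem_ofFn,
    ← Equiv.symm_apply_eq, Fin.ext_iff]

/-- Let `C ≥ 1` and let `e : Fin n ≃ V` enumerate the finite vertex set `V`
(each vertex loaded exactly once) into an initially empty LIFO cache of
capacity `C`.  Distinct vertices `u, w` are covered if and only if at least one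
of them occurs among the first `C - 1` loaded vertices, or both occur among the
first `min C n` loaded vertices. -/
theorem lifo_pair_covered_iff {V : Type*} [DecidableEq V] {n C : ℕ} (hC : 1 ≤ C)
    (e : Fin n ≃ V) (u w : V) (huw : u ≠ w) :
    coveredLIFO C (List.ofFn fun j => e j) u w ↔
      (((e.symm u : Fin n) : ℕ) < C - 1 ∨ ((e.symm w : Fin n) : ℕ) < C - 1) ∨
      (((e.symm u : Fin n) : ℕ) < min C n ∧ ((e.symm w : Fin n) : ℕ) < min C n) := by
  have hne : (e.symm u : ℕ) ≠ e.symm w := fun h => huw (e.symm.injective (Fin.ext h))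
  have hu := (e.symm u).isLt
  have hw := (e.symm w).isLt
  constructor
  · rintro ⟨i, hi, hui, hwi⟩
    rw [List.length_ofFn] at hi
    cases i with
    | zero => simp [lifoRun] at hui
    | succ k =>
      rw [mem_lifoRun_take_succ_iff hC e _ hi] at hui hwi
      omega
  · intro h
    have hmax : max (e.symm u : ℕ) (e.symm w) < n := max_lt hu hw
    refine ⟨max (e.symm u : ℕ) (e.symm w) + 1, by simp, ?_⟩
    rw [mem_lifoRun_take_succ_iff hC e _ hmax, mem_lifoRun_take_succ_iff hC e _ hmax]
    omega
end

section
/- Let G = (V, E) be a finite simple undirected graph with n = |V| vertices, let 1 ≤ C ≤ n, and let v_1, …, v_n be an enumeration of V loaded in order into an initially empty cache of capacity C under the LIFO eviction policy. Then every edge of G is covered by this schedule if and only if the tail set {v_C, v_{C+1}, …, v_n} is an independent set of G. -/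
/-- Once a vertex `x` has been loaded after `l`, the LIFO cache of capacity `k + 1` consists of `x`
on top of the first `k` vertices of `l`. -/
theorem lifoRun_concat {V : Type*} (k : ℕ) (l : List V) (x : V) :
    lifoRun (k + 1) (l ++ [x]) = x :: (l.take k).reverse := by
  induction l using List.reverseRecOn generalizing x with
  | nil => simp [lifoRun]
  | append_singleton l y ih =>
    have hstep : lifoRun (k + 1) (l ++ [y] ++ [x]) =
        if (lifoRun (k + 1) (l ++ [y])).length < k + 1 then x :: lifoRun (k + 1) (l ++ [y])
        else x :: (lifoRun (k + 1) (l ++ [y])).tail := by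
      simp [lifoRun, List.foldl_append]
    rw [hstep, ih]
    rcases lt_or_ge l.length k with h | h
    · rw [if_pos (by simp; omega), List.take_of_length_le h.le,
        List.take_of_length_le (by simp; omega)]
      simp
    · rw [if_neg (by simp; omega), List.take_append_of_le_length h, List.tail_cons]

theorem mem_lifoRun_take_succ {V : Type*} {n : ℕ} (k : ℕ) (e : Fin n ≃ V) (i j : Fin n) :
    e j ∈ lifoRun (k + 1) ((List.ofFn fun j => e j).take (i + 1)) ↔
      j = i ∨ j.val < k ∧ j.val < i.val := by
  rw [List.take_succ_eq_append_getElem (by simp), lifoRun_concat]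
  simp only [List.mem_cons, List.mem_reverse, List.take_take, List.mem_take_iff_getElem,
    List.getElem_ofFn, List.length_ofFn, e.injective.eq_iff]
  refine or_congr Iff.rfl ⟨?_, fun h => ⟨j, by omega, rfl⟩⟩
  rintro ⟨m, hm, rfl⟩
  simp only
  omega

/-- Let `G` be a finite simple graph on `n` vertices, `1 ≤ C ≤ n`, and let
`e : Fin n ≃ V` enumerate the vertices, loaded in order into an initially empty
LIFO cache of capacity `C`.  Every edge of `G` is covered by this schedule if
and only if the tail set `{v_C, v_{C+1}, …, v_n}` (the vertices loaded at
positions `C` through `n`, i.e. at 0-based indices `≥ C - 1`) is an independent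
set of `G`. -/
theorem lifo_covers_iff_tail_indep {V : Type*} [Fintype V] [DecidableEq V]
    (G : SimpleGraph V) {n C : ℕ} (hC1 : 1 ≤ C) (hCn : C ≤ n) (e : Fin n ≃ V) :
    (∀ u w : V, G.Adj u w → coveredLIFO C (List.ofFn fun j => e j) u w) ↔
      (∀ u ∈ Finset.image e (Finset.univ.filter fun j : Fin n => C - 1 ≤ j.val),
       ∀ w ∈ Finset.image e (Finset.univ.filter fun j : Fin n => C - 1 ≤ j.val),
        ¬ G.Adj u w) := by
  obtain ⟨k, rfl⟩ : ∃ k, C = k + 1 := ⟨C - 1, by omega⟩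
  simp only [Finset.forall_mem_image, Finset.mem_filter, Finset.mem_univ, true_and,
    Nat.add_sub_cancel]
  constructor
  · intro hcov a ha b hb hadj
    obtain ⟨i, hi, hu, hw⟩ := hcov _ _ hadj
    rw [List.length_ofFn] at hi
    cases i with
    | zero => simp [lifoRun] at hu
    | succ i =>
      have hu' := (mem_lifoRun_take_succ k e ⟨i, hi⟩ a).1 hu
      have hw' := (mem_lifoRun_take_succ k e ⟨i, hi⟩ b).1 hw
      obtain rfl : a = b := by
        rw [hu'.resolve_right (by omega), hw'.resolve_right (by omega)]
      exact G.loopless.irrefl _ hadj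
  · intro hind u w hadj
    obtain ⟨a, rfl⟩ := e.surjective u
    obtain ⟨b, rfl⟩ := e.surjective w
    have hab : a ≠ b := fun h => hadj.ne (congrArg e h)
    have hlt : a.val < k ∨ b.val < k := by
      by_contra! h
      exact hind h.1 h.2 hadj
    rcases lt_or_gt_of_ne hab with h | h
    · exact ⟨b + 1, by simp, (mem_lifoRun_take_succ k e b a).2 (by omega),
        (mem_lifoRun_take_succ k e b b).2 (Or.inl rfl)⟩
    · exact ⟨a + 1, by simp, (mem_lifoRun_take_succ k e a a).2 (Or.inl rfl),
        (mem_lifoRun_take_succ k e a b).2 (by omega)⟩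
end

section
/- Let G = (V, E) be a finite simple undirected graph with n = |V| vertices, let 1 ≤ T ≤ n, and set C = n − T + 1. Then there exists an enumeration v_1, …, v_n of V whose LIFO schedule with an initially empty cache of capacity C covers every edge of G (using exactly n loads) if and only if G has an independent set of size T. -/
theorem lifoRun_succ {V : Type*} (c : ℕ) (l : List V) :
    lifoRun (c + 1) l = (l.drop c).getLast?.toList ++ (l.take c).reverse := by
  induction l using List.reverseRecOn with
  | nil => simp [lifoRun]
  | append_singleton l x ih =>
    have hstep : lifoRun (c + 1) (l ++ [x]) =
        if (lifoRun (c + 1) l).length < c + 1 then x :: lifoRun (c + 1) l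
        else x :: (lifoRun (c + 1) l).tail := by
      simp [lifoRun, List.foldl_append]
    rw [hstep, ih]
    rcases lt_trichotomy l.length c with h | h | h
    · rw [List.take_of_length_le h.le, List.drop_of_length_le h.le,
        List.take_of_length_le (by simp; omega), List.drop_of_length_le (by simp; omega)]
      simp; omega
    · subst h
      simp
    · have hne : l.drop c ≠ [] := by simpa using h
      rw [List.drop_append_of_le_length h.le, List.take_append_of_le_length h.le,
        List.getLast?_eq_some_getLast hne]
      simp [h.le]

theorem coveredLIFO_of_mem_take {V : Type*} {c : ℕ} {l : List V} {u w : V}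
    (hu : u ∈ l) (hw : w ∈ l.take c) : coveredLIFO (c + 1) l u w := by
  rw [← List.take_append_drop c l, List.mem_append] at hu
  rcases hu with hu | hu
  · exact ⟨l.length, le_rfl, by simp [lifoRun_succ, hu], by simp [lifoRun_succ, hw]⟩
  · obtain ⟨k, hk, rfl⟩ := List.getElem_of_mem hu
    have hk' : c + k < l.length := by simp at hk; omega
    refine ⟨c + k + 1, hk', ?_, ?_⟩
    · rw [lifoRun_succ, List.mem_append]
      left
      rw [List.take_add_one, List.drop_append_of_le_length (by simp; omega)]
      simp [hk']
    · rw [lifoRun_succ, List.take_take, min_eq_left (by omega)]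
      simp [hw]

theorem coveredLIFO.symm {V : Type*} {C : ℕ} {l : List V} {u w : V}
    (h : coveredLIFO C l u w) : coveredLIFO C l w u := by
  obtain ⟨i, hi, hu, hw⟩ := h
  exact ⟨i, hi, hw, hu⟩

theorem eq_of_coveredLIFO_of_mem_drop {V : Type*} {c : ℕ} {l : List V} (hl : l.Nodup)
    {u w : V} (hu : u ∈ l.drop c) (hw : w ∈ l.drop c)
    (h : coveredLIFO (c + 1) l u w) : u = w := by
  obtain ⟨i, -, hui, hwi⟩ := h
  have key : ∀ x ∈ l.drop c, x ∈ lifoRun (c + 1) (l.take i) →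
      ((l.take i).drop c).getLast? = some x := by
    intro x hx hxi
    rw [lifoRun_succ, List.mem_append, Option.mem_toList, List.mem_reverse, List.take_take] at hxi
    rcases hxi with h | h
    · exact h
    · exact absurd hx
        (List.disjoint_take_drop hl le_rfl
          (List.take_subset_take_left l (min_le_left c i) h))
  exact Option.some_injective _ ((key u hu hui).symm.trans (key w hw hwi))

theorem List.Nodup.exists_equiv_ofFn_eq {V : Type*} [DecidableEq V] {n : ℕ} {l : List V}
    (hl : l.Nodup) (hmem : ∀ x, x ∈ l) (hlen : l.length = n) :
    ∃ e : Fin n ≃ V, List.ofFn (fun j => e j) = l := by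
  subst hlen
  exact ⟨hl.getEquivOfForallMemList l hmem, List.ofFn_get l⟩

/-- Correctness of the reduction from Independent Set (Theorem 4.2): for a finite
simple graph `G` on `n` vertices and `1 ≤ T ≤ n`, setting `C = n - T + 1`, there
is an enumeration of the vertices whose LIFO schedule with an initially empty
cache of capacity `C` (using exactly `n` loads) covers every edge of `G` if and
only if `G` has an independent set of size `T`. -/
theorem lifo_cover_iff_indep_set {V : Type*} [Fintype V] [DecidableEq V]
    (G : SimpleGraph V) (n T : ℕ) (hn : n = Fintype.card V)
    (hT1 : 1 ≤ T) (hTn : T ≤ n) :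
    (∃ e : Fin n ≃ V,
      ∀ u w : V, G.Adj u w →
        coveredLIFO (n - T + 1) (List.ofFn fun j => e j) u w) ↔
    (∃ S : Finset V, S.card = T ∧ ∀ u ∈ S, ∀ w ∈ S, ¬ G.Adj u w) := by
  constructor
  · rintro ⟨e, he⟩
    have hl : (List.ofFn fun j => e j).Nodup := List.nodup_ofFn.2 e.injective
    refine ⟨((List.ofFn fun j => e j).drop (n - T)).toFinset, ?_, ?_⟩
    · rw [List.toFinset_card_of_nodup (hl.sublist (List.drop_sublist _ _))]
      simp; omega
    · intro u hu w hw huw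
      exact huw.ne (eq_of_coveredLIFO_of_mem_drop hl (List.mem_toFinset.1 hu)
        (List.mem_toFinset.1 hw) (he u w huw))
  · rintro ⟨S, hS, hind⟩
    have hcard : Sᶜ.toList.length = n - T := by
      rw [Finset.length_toList, Finset.card_compl, hS, hn]
    have hmem : ∀ x, x ∈ Sᶜ.toList ++ S.toList := fun x => by simp [em']
    obtain ⟨e, he⟩ := List.Nodup.exists_equiv_ofFn_eq (n := n) (l := Sᶜ.toList ++ S.toList)
      (List.nodup_append'.2 ⟨Finset.nodup_toList _, Finset.nodup_toList _,
        fun x hx hx' => by simp at hx hx'; exact hx hx'⟩) hmem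
      (by rw [List.length_append, hcard, Finset.length_toList, hS]; omega)
    refine ⟨e, fun u w huw => ?_⟩
    have htake : ∀ x ∉ S, x ∈ (Sᶜ.toList ++ S.toList).take (n - T) := fun x hx => by
      rw [← hcard, List.take_left]
      simpa using hx
    rw [he]
    by_cases hw : w ∈ S
    · exact (coveredLIFO_of_mem_take (hmem w)
        (htake u fun hu => hind u hu w hw huw)).symm
    · exact coveredLIFO_of_mem_take (hmem u) (htake w hw)
end

section
/- Let a_1, …, a_m be a finite access sequence of elements and let C ≥ 1 be the cache capacity. Then the number of misses incurred by Belady's policy on this sequence is less than or equal to the number of misses incurred by any eviction schedule on the same sequence with the same capacity. -/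
/-- `s` is the sequence of cache states of a valid eviction schedule for the
access sequence `a 0, …, a (m-1)` on an initially empty cache of capacity `C`:
processing access `a i`, if `a i` is cached it is a hit and the cache is
unchanged; otherwise it is a miss, `a i` is inserted, and if the cache already
holds `C` elements one cached element (chosen by the schedule) is first
evicted. -/
def IsSchedule {α : Type*} [DecidableEq α] (C m : ℕ) (a : ℕ → α)
    (s : ℕ → Finset α) : Prop :=
  s 0 = ∅ ∧ ∀ i < m,
    (a i ∈ s i ∧ s (i + 1) = s i) ∨
    (a i ∉ s i ∧
      (((s i).card < C ∧ s (i + 1) = insert (a i) (s i)) ∨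
       ((s i).card = C ∧ ∃ y ∈ s i, s (i + 1) = insert (a i) ((s i).erase y))))

/-- The index of the next access of `x` strictly after time `i` in the access
sequence `a 0, …, a (m-1)`; elements never accessed again get the value `m`,
which is latest of all. -/
noncomputable def nextUse {α : Type*} (a : ℕ → α) (m i : ℕ) (x : α) : ℕ :=
  open Classical in
  if h : {j : ℕ | i < j ∧ j < m ∧ a j = x}.Nonempty
  then sInf {j : ℕ | i < j ∧ j < m ∧ a j = x} else m

/-- At time `i` the schedule `s` follows Belady's policy: upon a miss with a full
cache, it evicts a cached element whose next access strictly after time `i`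
occurs latest in the sequence (never-again-accessed elements being latest of
all). -/
def IsBeladyAt {α : Type*} [DecidableEq α] (C m : ℕ) (a : ℕ → α)
    (s : ℕ → Finset α) (i : ℕ) : Prop :=
  a i ∉ s i → (s i).card = C →
    ∃ y ∈ s i, s (i + 1) = insert (a i) ((s i).erase y) ∧
      ∀ z ∈ s i, nextUse a m i z ≤ nextUse a m i y

/-- The number of misses incurred by the schedule with states `s` on the accesses
`a 0, …, a (m-1)`. -/
def missCount {α : Type*} [DecidableEq α] (m : ℕ) (a : ℕ → α)
    (s : ℕ → Finset α) : ℕ :=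
  ((Finset.range m).filter fun i => a i ∉ s i).card

/-- The elements accessed at some time in `[i, t)`. -/
def accessed {α : Type*} [DecidableEq α] (a : ℕ → α) (i t : ℕ) : Finset α :=
  (Finset.Ico i t).image a

theorem accessed_eq_insert {α : Type*} [DecidableEq α] (a : ℕ → α) {i t : ℕ} (h : i < t) :
    accessed a i t = insert (a i) (accessed a (i + 1) t) := by
  rw [accessed, accessed, ← Finset.image_insert, Finset.insert_Ico_add_one_left_eq_Ico h]

theorem accessed_self {α : Type*} [DecidableEq α] (a : ℕ → α) (i : ℕ) :
    accessed a i i = ∅ := by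
  simp [accessed]

theorem mem_accessed_of_nextUse_le {α : Type*} [DecidableEq α] {a : ℕ → α} {m i t : ℕ}
    {y z : α} (ht : t ≤ m) (hy : y ∈ accessed a (i + 1) t)
    (hzy : nextUse a m i z ≤ nextUse a m i y) : z ∈ accessed a (i + 1) t := by
  simp only [accessed, Finset.mem_image, Finset.mem_Ico] at hy ⊢
  obtain ⟨j, ⟨hij, hjt⟩, hj⟩ := hy
  have hjmem : j ∈ {j : ℕ | i < j ∧ j < m ∧ a j = y} := ⟨hij, by omega, hj⟩
  have hlt : nextUse a m i z < t := by
    refine hzy.trans_lt (lt_of_le_of_lt ?_ hjt)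
    rw [nextUse, dif_pos ⟨j, hjmem⟩]
    exact Nat.sInf_le hjmem
  by_cases hne : {j : ℕ | i < j ∧ j < m ∧ a j = z}.Nonempty
  · rw [nextUse, dif_pos hne] at hlt
    obtain ⟨h1, -, h3⟩ := Nat.sInf_mem hne
    exact ⟨_, ⟨h1, hlt⟩, h3⟩
  · rw [nextUse, dif_neg hne] at hlt
    omega

namespace IsSchedule

variable {α : Type*} [DecidableEq α] {C m : ℕ} {a : ℕ → α} {s : ℕ → Finset α}

theorem mem_succ (h : IsSchedule C m a s) {i : ℕ} (hi : i < m) : a i ∈ s (i + 1) := by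
  rcases h.2 i hi with ⟨hx, e⟩ | ⟨-, ⟨-, e⟩ | ⟨-, y, -, e⟩⟩ <;> simp [*]

theorem erase_succ_subset (h : IsSchedule C m a s) {i : ℕ} (hi : i < m) :
    (s (i + 1)).erase (a i) ⊆ (s i).erase (a i) := by
  intro z
  rcases h.2 i hi with ⟨hx, e⟩ | ⟨-, ⟨-, e⟩ | ⟨-, y, -, e⟩⟩ <;>
    simp only [e, Finset.mem_erase, Finset.mem_insert] <;> tauto

theorem card_le (h : IsSchedule C m a s) {i : ℕ} (hi : i ≤ m) : (s i).card ≤ C := by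
  induction i with
  | zero => simp [h.1]
  | succ i ih =>
    have ih := ih (by omega)
    rcases h.2 i hi with ⟨hx, e⟩ | ⟨-, ⟨hc, e⟩ | ⟨hc, y, hy, e⟩⟩
    · rwa [e]
    · rw [e]
      exact (Finset.card_insert_le _ _).trans hc
    · rw [e]
      have := Finset.card_insert_le (a i) ((s i).erase y)
      have := Finset.card_erase_add_one hy
      omega

theorem card_erase_succ_lt (h : IsSchedule C m a s) {i : ℕ} (hi : i < m) :
    ((s (i + 1)).erase (a i)).card < C :=
  (Finset.card_erase_lt_of_mem (h.mem_succ hi)).trans_le (h.card_le hi)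

/-- A Belady step either keeps every cached element of `accessed a (i + 1) t`, or leaves
only elements of `accessed a (i + 1) t` (besides the one just accessed) in a full cache. -/
theorem belady_step (h : IsSchedule C m a s) {i t : ℕ} (hi : i < m) (ht : t ≤ m)
    (hb : IsBeladyAt C m a s i) :
    (s (i + 1)).erase (a i) ∩ accessed a (i + 1) t = (s i).erase (a i) ∩ accessed a (i + 1) t ∨
      (a i ∉ s i ∧ C ≤ ((s (i + 1)).erase (a i) ∩ accessed a (i + 1) t).card + 1) := by
  rcases h.2 i hi with ⟨-, e⟩ | ⟨hx, ⟨-, e⟩ | ⟨hc, -⟩⟩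
  · simp [e]
  · simp [e, hx]
  · obtain ⟨y, hy, e, hmax⟩ := hb hx hc
    have e' : (s (i + 1)).erase (a i) = (s i).erase y := by
      rw [e, Finset.erase_insert fun hm => hx (Finset.mem_of_mem_erase hm)]
    rw [e', Finset.erase_eq_of_notMem hx]
    by_cases hyW : y ∈ accessed a (i + 1) t
    · refine Or.inr ⟨hx, ?_⟩
      rw [Finset.inter_eq_left.2 fun z hz =>
        mem_accessed_of_nextUse_le ht hyW (hmax z (Finset.mem_of_mem_erase hz)),
        Finset.card_erase_add_one hy, hc]
    · left
      rw [Finset.erase_inter, Finset.erase_eq_of_notMem]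
      simp [hyW]

end IsSchedule

theorem card_inter_insert {α : Type*} [DecidableEq α] (S W : Finset α) (x : α) :
    (S ∩ insert x W).card = (S.erase x ∩ W).card + if x ∈ S then 1 else 0 := by
  split_ifs with hx
  · rw [← Finset.card_insert_of_notMem (s := S.erase x ∩ W) (a := x) (by simp)]
    congr 1
    ext z
    by_cases hz : z = x <;> simp [hz, hx]
  · rw [Finset.inter_insert_of_notMem hx, Finset.erase_eq_of_notMem hx, add_zero]

theorem card_inter_of_mem {α : Type*} [DecidableEq α] {S : Finset α} {x : α} (hx : x ∈ S)
    (W : Finset α) :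
    (S ∩ W).card = (S.erase x ∩ W).card + if x ∈ W then 1 else 0 := by
  split_ifs with hW
  · rw [Finset.erase_inter, Finset.card_erase_add_one (by simp [hx, hW])]
  · rw [Finset.erase_inter, Finset.erase_eq_of_notMem (by simp [hW])]
    rfl

theorem missCount_succ {α : Type*} [DecidableEq α] (i : ℕ) (a : ℕ → α) (s : ℕ → Finset α) :
    missCount (i + 1) a s + (if a i ∈ s i then 1 else 0) = missCount i a s + 1 := by
  rw [missCount, missCount, Finset.range_add_one, Finset.filter_insert]
  split_ifs <;> simp_all

/-- For every horizon `t`, the surplus of elements accessed in `[i, t)` that an arbitrary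
schedule caches over those that Belady's policy caches is paid for by additional misses. -/
theorem missCount_add_card_inter_accessed_le {α : Type*} [DecidableEq α] {C m : ℕ} {a : ℕ → α}
    {sB sA : ℕ → Finset α} (hB : IsSchedule C m a sB)
    (hBel : ∀ i < m, IsBeladyAt C m a sB i) (hA : IsSchedule C m a sA) {i : ℕ} (hi : i ≤ m) :
    ∀ t, i ≤ t → t ≤ m → missCount i a sB + (sA i ∩ accessed a i t).card ≤
      missCount i a sA + (sB i ∩ accessed a i t).card := by
  induction i with
  | zero => simp [hA.1, hB.1, missCount]
  | succ i ih =>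
    intro t hit htm
    have him : i < m := hi
    have h1 := ih him.le (i + 1) (by omega) hi
    have h2 := ih him.le t (by omega) htm
    rw [accessed_eq_insert a (Nat.lt_succ_self i), accessed_self,
      card_inter_insert, card_inter_insert, Finset.inter_empty, Finset.inter_empty] at h1
    rw [accessed_eq_insert a hit, card_inter_insert, card_inter_insert] at h2
    rw [card_inter_of_mem (hA.mem_succ him), card_inter_of_mem (hB.mem_succ him)]
    have hmB := missCount_succ i a sB
    have hmA := missCount_succ i a sA
    have hsub := Finset.card_le_card (Finset.inter_subset_inter_right
      (u := accessed a (i + 1) t) (hA.erase_succ_subset him))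
    have hlt := (Finset.card_le_card (Finset.inter_subset_left
      (s₂ := accessed a (i + 1) t))).trans_lt (hA.card_erase_succ_lt him)
    rw [Finset.card_empty] at h1
    rcases hB.belady_step him htm (hBel i him) with h | ⟨hx, h⟩
    · rw [h]
      omega
    · rw [if_neg hx] at h1 hmB
      omega

/-- Optimality of Belady's algorithm (Section 4.2): on any finite access sequence
`a 0, …, a (m-1)` with cache capacity `C ≥ 1`, the number of misses incurred by
Belady's policy is at most the number of misses incurred by any eviction
schedule on the same sequence with the same capacity. -/
theorem belady_optimal {α : Type*} [DecidableEq α] (C m : ℕ) (hC : 1 ≤ C)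
    (a : ℕ → α) (sB sA : ℕ → Finset α)
    (hB : IsSchedule C m a sB) (hBel : ∀ i < m, IsBeladyAt C m a sB i)
    (hA : IsSchedule C m a sA) :
    missCount m a sB ≤ missCount m a sA := by
  simpa [accessed_self] using
    missCount_add_card_inter_accessed_le hB hBel hA le_rfl m le_rfl le_rfl
end

section
/- Let a_1, …, a_m be a finite access sequence, let C ≥ 1 be the cache capacity, and let A be any eviction schedule that agrees with Belady's policy on every eviction decision made strictly before some miss at time t. Then there exists an eviction schedule A' that agrees with Belady's policy on every eviction decision up to and including the miss at time t and incurs no more misses on the whole sequence than A does. -/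
/-- The schedule `s` can be followed from time `k` on starting from the cache state `S`
instead of `s k`, at the price of at most `e` additional misses. -/
def CanFollow {α : Type*} [DecidableEq α] (C m : ℕ) (a : ℕ → α) (s : ℕ → Finset α)
    (k : ℕ) (S : Finset α) (e : ℕ) : Prop :=
  ∃ s' : ℕ → Finset α, s' k = S ∧
    (∀ i, k ≤ i → i < m →
      (a i ∈ s' i ∧ s' (i + 1) = s' i) ∨
      (a i ∉ s' i ∧
        (((s' i).card < C ∧ s' (i + 1) = insert (a i) (s' i)) ∨
         ((s' i).card = C ∧ ∃ y ∈ s' i, s' (i + 1) = insert (a i) ((s' i).erase y))))) ∧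
    ∑ i ∈ Finset.Ico k m, (if a i ∉ s' i then 1 else 0) ≤
      ∑ i ∈ Finset.Ico k m, (if a i ∉ s i then 1 else 0) + e

theorem CanFollow.refl {α : Type*} [DecidableEq α] {C m : ℕ} {a : ℕ → α}
    {s : ℕ → Finset α} (hs : IsSchedule C m a s) (k e : ℕ) :
    CanFollow C m a s k (s k) e :=
  ⟨s, rfl, fun i _ hi => hs.2 i hi, Nat.le_add_right _ _⟩

theorem CanFollow.cons {α : Type*} [DecidableEq α] {C m : ℕ} {a : ℕ → α}
    {s : ℕ → Finset α} {k e e' : ℕ} {S T : Finset α} (hk : k < m)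
    (hstep : (a k ∈ S ∧ T = S) ∨
      (a k ∉ S ∧ ((S.card < C ∧ T = insert (a k) S) ∨
        (S.card = C ∧ ∃ y ∈ S, T = insert (a k) (S.erase y)))))
    (he : (if a k ∉ S then 1 else 0) + e' ≤ (if a k ∉ s k then 1 else 0) + e)
    (h : CanFollow C m a s (k + 1) T e') : CanFollow C m a s k S e := by
  obtain ⟨s', rfl, hs', hc⟩ := h
  have hne : ∀ i, k + 1 ≤ i → Function.update s' k S i = s' i := fun i hi =>
    Function.update_of_ne (by omega) _ _
  refine ⟨Function.update s' k S, Function.update_self .., fun i hki him => ?_, ?_⟩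
  · rcases hki.eq_or_lt with rfl | hlt
    · rwa [Function.update_self, hne _ le_rfl]
    · rw [hne i hlt, hne (i + 1) (by omega)]
      exact hs' i hlt him
  · rw [Finset.sum_eq_sum_Ico_succ_bot hk, Finset.sum_eq_sum_Ico_succ_bot hk,
      Function.update_self]
    have hsum : ∑ i ∈ Finset.Ico (k + 1) m, (if a i ∉ Function.update s' k S i then 1 else 0) =
        ∑ i ∈ Finset.Ico (k + 1) m, (if a i ∉ s' i then 1 else 0) :=
      Finset.sum_congr rfl fun i hi => by rw [hne i (Finset.mem_Ico.1 hi).1]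
    omega

/-- A full cache holding `z` in place of `b` costs at most one additional miss, and none if `z`
is accessed before `b`. -/
theorem CanFollow.of_swap {α : Type*} [DecidableEq α] {C m : ℕ} {a : ℕ → α}
    {s : ℕ → Finset α} (hs : IsSchedule C m a s) {b : α} (k e : ℕ) (z : α) (X : Finset α)
    (hk : k ≤ m) (hsk : s k = insert b X) (hb : b ∉ X) (hz : z ∉ X) (hbz : b ≠ z)
    (hX : X.card + 1 = C)
    (he : 1 ≤ e ∨ ∀ j, k ≤ j → j < m → a j = b → ∃ i, k ≤ i ∧ i < j ∧ a i = z) :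
    CanFollow C m a s k (insert z X) e := by
  induction hk using Nat.decreasingInduction generalizing e z X with
  | self => exact ⟨fun _ => insert z X, rfl, fun i h1 h2 => by omega, by simp⟩
  | of_succ k hk ih =>
    replace hk : k < m := hk
    have hcardb : (insert b X).card = C := by rw [Finset.card_insert_of_notMem hb, hX]
    have hcardz : (insert z X).card = C := by rw [Finset.card_insert_of_notMem hz, hX]
    have persist : a k ≠ z →
        1 ≤ e ∨ ∀ j, k + 1 ≤ j → j < m → a j = b → ∃ i, k + 1 ≤ i ∧ i < j ∧ a i = z := by
      intro hne
      refine he.imp_right fun h j hj hjm hjb => ?_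
      obtain ⟨i, hi, hij, hiz⟩ := h j (by omega) hjm hjb
      have : i ≠ k := by rintro rfl; exact hne hiz
      exact ⟨i, by omega, hij, hiz⟩
    have hstep := hs.2 k hk
    rw [hsk] at hstep
    rcases hstep with ⟨hmem, hnext⟩ | ⟨hmem, ⟨hlt, -⟩ | ⟨-, y, hy, hnext⟩⟩
    · by_cases hcb : a k = b
      · have he1 : 1 ≤ e := he.resolve_right fun h => by
          obtain ⟨i, hi, hik, -⟩ := h k le_rfl hk hcb
          omega
        refine CanFollow.cons (e' := e - 1) hk
          (Or.inr ⟨by grind, Or.inr ⟨hcardz, z, by simp, ?_⟩⟩) ?_ (.refl hs _ _)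
        · rw [hnext, hcb, Finset.erase_insert hz]
        · split_ifs <;> omega
      · have hcX : a k ∈ X := Finset.mem_of_mem_insert_of_ne hmem hcb
        refine CanFollow.cons hk (Or.inl ⟨by grind, rfl⟩) (e' := e) (by grind)
          (ih e z X hnext hb hz hbz hX (persist ?_))
        rintro rfl
        exact hz hcX
    · omega
    · have hcX : a k ∉ X := fun h => hmem (Finset.mem_insert_of_mem h)
      have hcb : a k ≠ b := fun h => hmem (h ▸ Finset.mem_insert_self _ _)
      by_cases hyb : y = b
      · subst hyb
        rw [Finset.erase_insert hb] at hnext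
        by_cases hcz : a k = z
        · exact CanFollow.cons hk (Or.inl ⟨by grind, by grind⟩) (e' := e) (by grind)
            (.refl hs _ _)
        · refine CanFollow.cons hk (Or.inr ⟨by grind, Or.inr ⟨hcardz, z, by simp, ?_⟩⟩)
            (e' := e) (by grind) (.refl hs _ _)
          rw [hnext, Finset.erase_insert hz]
      · have hyX : y ∈ X := Finset.mem_of_mem_insert_of_ne hy hyb
        have hcard : (insert (a k) (X.erase y)).card + 1 = C := by
          rw [Finset.card_insert_of_notMem (fun h => hcX (Finset.mem_of_mem_erase h)),
            Finset.card_erase_add_one hyX, hX]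
        have hnext' : s (k + 1) = insert b (insert (a k) (X.erase y)) := by
          rw [hnext]; grind
        by_cases hcz : a k = z
        · exact CanFollow.cons hk (Or.inl ⟨by grind, by grind⟩) (e' := 1) (by grind)
            (ih 1 y (insert (a k) (X.erase y)) hnext' (by grind) (by grind) (by grind) hcard
              (Or.inl le_rfl))
        · exact CanFollow.cons hk
            (Or.inr ⟨by grind, Or.inr ⟨hcardz, y, by grind, by grind⟩⟩) (e' := e) (by grind)
            (ih e z (insert (a k) (X.erase y)) hnext' (by grind) (by grind) hbz hcard
              (persist hcz))

theorem nextUse_le {α : Type*} {a : ℕ → α} {m i j : ℕ} (hij : i < j) (hjm : j < m) :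
    nextUse a m i (a j) ≤ j := by
  have hj : j ∈ {l : ℕ | i < l ∧ l < m ∧ a l = a j} := ⟨hij, hjm, rfl⟩
  rw [nextUse, dif_pos ⟨j, hj⟩]
  exact Nat.sInf_le hj

theorem nextUse_spec {α : Type*} {a : ℕ → α} {m i : ℕ} {x : α} (h : nextUse a m i x < m) :
    i < nextUse a m i x ∧ a (nextUse a m i x) = x := by
  rw [nextUse] at h ⊢
  split_ifs at h ⊢ with hne
  · exact ⟨(Nat.sInf_mem hne).1, (Nat.sInf_mem hne).2.2⟩
  · omega

/-- Exchange step in the proof of Belady optimality: let `sA` be any eviction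
schedule for the access sequence `a 0, …, a (m-1)` with capacity `C ≥ 1` that
agrees with Belady's policy on every eviction decision made strictly before some
miss at time `t`.  Then there exists an eviction schedule `sA'` that agrees with
Belady's policy on every eviction decision up to and including the miss at time
`t` and incurs no more misses on the whole sequence than `sA` does. -/
theorem belady_exchange {α : Type*} [DecidableEq α] (C m : ℕ) (hC : 1 ≤ C)
    (a : ℕ → α) (sA : ℕ → Finset α) (hA : IsSchedule C m a sA)
    (t : ℕ) (ht : t < m) (hmiss : a t ∉ sA t)
    (hagree : ∀ i < t, IsBeladyAt C m a sA i) :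
    ∃ sA' : ℕ → Finset α, IsSchedule C m a sA' ∧
      (∀ i ≤ t, IsBeladyAt C m a sA' i) ∧
      missCount m a sA' ≤ missCount m a sA := by
  by_cases hbel : IsBeladyAt C m a sA t
  · refine ⟨sA, hA, fun i hi => ?_, le_rfl⟩
    rcases hi.eq_or_lt with rfl | hlt
    exacts [hbel, hagree i hlt]
  obtain ⟨-, hfull⟩ : a t ∉ sA t ∧ (sA t).card = C := by
    unfold IsBeladyAt at hbel
    tauto
  obtain ⟨y, hy, hnext⟩ : ∃ y ∈ sA t, sA (t + 1) = insert (a t) ((sA t).erase y) := by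
    rcases hA.2 t ht with ⟨h, -⟩ | ⟨-, ⟨h, -⟩ | ⟨-, h⟩⟩
    exacts [absurd h hmiss, absurd hfull h.ne, h]
  obtain ⟨b, hb, hmax⟩ := (sA t).exists_max_image (nextUse a m t)
    (Finset.card_pos.1 (by omega))
  have hlt : nextUse a m t y < nextUse a m t b := by
    by_contra! hle
    exact hbel fun _ _ => ⟨y, hy, hnext, fun z hz => (hmax z hz).trans hle⟩
  have hby : b ≠ y := by
    rintro rfl
    exact hlt.false
  have hyb : y ∈ (sA t).erase b := Finset.mem_erase.2 ⟨hby.symm, hy⟩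
  have hcard : (insert (a t) (((sA t).erase b).erase y)).card + 1 = C := by
    rw [Finset.card_insert_of_notMem (by grind), Finset.card_erase_add_one hyb,
      Finset.card_erase_of_mem hb]
    omega
  obtain ⟨s', hs0, hs', hc⟩ := CanFollow.of_swap hA (b := b) (t + 1) 0 y
    (insert (a t) (((sA t).erase b).erase y)) ht (by rw [hnext]; grind) (by grind) (by grind)
    hby hcard (Or.inr fun j hj hjm hjb => by
      have hle := nextUse_le (a := a) (show t < j by omega) hjm
      rw [hjb] at hle
      have hspec := nextUse_spec (hlt.trans_le (hle.trans hjm.le))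
      exact ⟨_, hspec.1, hlt.trans_le hle, hspec.2⟩)
  replace hs0 : s' (t + 1) = insert (a t) ((sA t).erase b) := by rw [hs0]; grind
  have hlo : ∀ i ≤ t, (if i ≤ t then sA i else s' i) = sA i := fun i hi => if_pos hi
  have hhi : ∀ i, t + 1 ≤ i → (if i ≤ t then sA i else s' i) = s' i := fun i hi =>
    if_neg (by omega)
  refine ⟨fun i => if i ≤ t then sA i else s' i, ⟨?_, fun i him => ?_⟩, fun i hi => ?_, ?_⟩
  · simp [hA.1]
  · dsimp only
    rcases lt_trichotomy i t with h | rfl | h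
    · rw [hlo i h.le, hlo (i + 1) h]
      exact hA.2 i him
    · rw [hlo i le_rfl, hhi (i + 1) le_rfl]
      exact Or.inr ⟨hmiss, Or.inr ⟨hfull, b, hb, hs0⟩⟩
    · rw [hhi i h, hhi (i + 1) (by omega)]
      exact hs' i h him
  · unfold IsBeladyAt
    dsimp only
    rcases hi.eq_or_lt with rfl | h
    · rw [hlo i le_rfl, hhi (i + 1) le_rfl]
      exact fun _ _ => ⟨b, hb, hs0, hmax⟩
    · rw [hlo i hi, hlo (i + 1) h]
      exact hagree i h
  · simp only [missCount, Finset.card_filter]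
    rw [Finset.range_eq_Ico, ← Finset.sum_Ico_consecutive _ (Nat.zero_le (t + 1)) ht,
      ← Finset.sum_Ico_consecutive _ (Nat.zero_le (t + 1)) ht]
    refine add_le_add (Finset.sum_le_sum fun i hi => ?_) (le_trans (Finset.sum_le_sum ?_) hc)
    · rw [hlo i (Nat.lt_succ_iff.1 (Finset.mem_Ico.1 hi).2)]
    · intro i hi
      rw [hhi i (Finset.mem_Ico.1 hi).1]
end

section
/- Let r and s be finite subsets of a linearly ordered set and let t ≥ 1 be an integer. If |r ∩ s| ≥ t, then the set of the |r| − t + 1 smallest elements of r and the set of the |s| − t + 1 smallest elements of s have at least one element in common. -/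
/-- An element of `u` with fewer than `k` smaller elements in `u` is among the `k` smallest. -/
theorem Finset.mem_take_sort_of_card_filter_lt {α : Type*} [LinearOrder α] {u : Finset α}
    {x : α} {k : ℕ} (hx : x ∈ u) (hk : (u.filter (· < x)).card < k) :
    x ∈ (u.sort (· ≤ ·)).take k := by
  by_contra hn
  have hsplit := List.take_append_drop k (u.sort (· ≤ ·))
  have hdrop : x ∈ (u.sort (· ≤ ·)).drop k := by
    have hmem : x ∈ u.sort (· ≤ ·) := (Finset.mem_sort _).2 hx
    rw [← hsplit, List.mem_append] at hmem
    exact hmem.resolve_left hn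
  have hle := u.pairwise_sort (· ≤ ·)
  rw [← hsplit, List.pairwise_append] at hle
  have hsub : ((u.sort (· ≤ ·)).take k).toFinset ⊆ u.filter (· < x) := by
    intro y hy
    rw [List.mem_toFinset] at hy
    refine Finset.mem_filter.2 ⟨(Finset.mem_sort (· ≤ ·)).1 (List.mem_of_mem_take hy), ?_⟩
    exact lt_of_le_of_ne (hle.2.2 y hy x hdrop) fun hyx => hn (hyx ▸ hy)
  have hcard := Finset.card_le_card hsub
  rw [List.toFinset_card_of_nodup ((u.sort_nodup _).sublist (List.take_sublist _ _)),
    List.length_take] at hcard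
  have hpos := List.length_pos_of_mem hdrop
  rw [List.length_drop] at hpos
  omega

/-- If `u` has at least `t` elements that are `≥ x`, one of them being `x`, then `x` is among the
`|u| - t + 1` smallest elements of `u`. -/
theorem Finset.mem_take_sort_of_le {α : Type*} [LinearOrder α] {u v : Finset α} {x : α} {t : ℕ}
    (hx : x ∈ u) (hv : v ⊆ u) (hxv : ∀ y ∈ v, x ≤ y) (ht : t ≤ v.card) :
    x ∈ (u.sort (· ≤ ·)).take (u.card - t + 1) := by
  apply Finset.mem_take_sort_of_card_filter_lt hx
  have hsub : u.filter (· < x) ⊆ u \ v := fun y hy => by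
    rw [Finset.mem_filter] at hy
    exact Finset.mem_sdiff.2 ⟨hy.1, fun hyv => (hxv y hyv).not_gt hy.2⟩
  have hcard := Finset.card_le_card hsub
  rw [Finset.card_sdiff_of_subset hv] at hcard
  omega

/-- Prefix-filtering property (Section 2): let `r` and `s` be finite subsets of a
linearly ordered set and `t ≥ 1`.  If `|r ∩ s| ≥ t`, then the set of the
`|r| - t + 1` smallest elements of `r` (the length-`(|r| - t + 1)` prefix of `r`
in sorted order) and the set of the `|s| - t + 1` smallest elements of `s`
have at least one element in common. -/
theorem prefix_filtering {α : Type*} [LinearOrder α] (r s : Finset α) (t : ℕ)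
    (ht : 1 ≤ t) (h : t ≤ (r ∩ s).card) :
    (((r.sort (· ≤ ·)).take (r.card - t + 1)).toFinset ∩
      ((s.sort (· ≤ ·)).take (s.card - t + 1)).toFinset).Nonempty := by
  have hne : (r ∩ s).Nonempty := Finset.card_pos.1 (ht.trans h)
  have hmin := Finset.mem_inter.1 ((r ∩ s).min'_mem hne)
  have hle : ∀ y ∈ r ∩ s, (r ∩ s).min' hne ≤ y := fun y hy => (r ∩ s).min'_le y hy
  refine ⟨(r ∩ s).min' hne, Finset.mem_inter.2 ⟨List.mem_toFinset.2 ?_, List.mem_toFinset.2 ?_⟩⟩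
  · exact Finset.mem_take_sort_of_le hmin.1 Finset.inter_subset_left hle h
  · exact Finset.mem_take_sort_of_le hmin.2 Finset.inter_subset_right hle h
end
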